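/- arXiv:1303.3029 — 4 statements merged into one kernel-verified Lean document; each statement's English description precedes it below -/
import Mathlib

section
/- Let ξ(t), t ∈ ℝ, be a 2π-periodic, jointly measurable, centered Gaussian process with continuous covariance function R(t,s) = E[ξ(t)ξ(s)]. Define the modulus of continuity ω(R,δ) = sup_{|h₁|≤δ, |h₂|≤δ} sup_{t,s} |R(t+h₁, s+h₂) − R(t,s)|. If ∫₀^∞ ω(R, e^{−x²})^{1/2} dx < ∞ (Fernique's condition), then ξ has a modification with almost surely continuous sample paths. -/
open MeasureTheory Real Set ProbabilityTheory

noncomputable section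

/-- A (jointly measurable) family `ξ` is a centered Gaussian process: every finite real
linear combination of its values is a centered (possibly degenerate) Gaussian variable. -/
def IsCenteredGaussianProcess {Ω : Type*} [MeasurableSpace Ω] (P : Measure Ω)
    (ξ : ℝ → Ω → ℝ) : Prop :=
  ∀ (k : ℕ) (c : Fin k → ℝ) (t : Fin k → ℝ), ∃ v : NNReal,
    Measure.map (fun ω => ∑ i, c i * ξ (t i) ω) P = gaussianReal 0 v

/-- The (bivariate) modulus of continuity
`ω(R,δ) = sup_{|h₁|≤δ, |h₂|≤δ} sup_{t,s} |R(t+h₁,s+h₂) − R(t,s)|`. -/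
noncomputable def modCont2 (R : ℝ → ℝ → ℝ) (δ : ℝ) : ℝ :=
  ⨆ (h : ℝ × ℝ) (_ : |h.1| ≤ δ ∧ |h.2| ≤ δ) (ts : ℝ × ℝ),
    |R (ts.1 + h.1) (ts.2 + h.2) - R ts.1 ts.2|

open Filter Topology

section ModulusOfContinuity

variable {R : ℝ → ℝ → ℝ} {B : ℝ}

lemma modCont2_nonneg (R : ℝ → ℝ → ℝ) (δ : ℝ) : 0 ≤ modCont2 R δ :=
  Real.iSup_nonneg fun _ => Real.iSup_nonneg fun _ => Real.iSup_nonneg fun _ => abs_nonneg _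

lemma modCont2_le {δ C : ℝ} (hC : 0 ≤ C)
    (h : ∀ h₁ h₂ t s, |h₁| ≤ δ → |h₂| ≤ δ → |R (t + h₁) (s + h₂) - R t s| ≤ C) :
    modCont2 R δ ≤ C :=
  Real.iSup_le (fun p => Real.iSup_le (fun hp => Real.iSup_le
    (fun q => h p.1 p.2 q.1 q.2 hp.1 hp.2) hC) hC) hC

lemma abs_sub_le_modCont2 (hB : ∀ t s, |R t s| ≤ B) {δ h₁ h₂ : ℝ} (hh₁ : |h₁| ≤ δ)
    (hh₂ : |h₂| ≤ δ) (t s : ℝ) : |R (t + h₁) (s + h₂) - R t s| ≤ modCont2 R δ := by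
  have hB0 : 0 ≤ B := (abs_nonneg _).trans (hB 0 0)
  have key : ∀ a b c d : ℝ, |R a b - R c d| ≤ B + B := fun a b c d =>
    (abs_sub _ _).trans (add_le_add (hB a b) (hB c d))
  have hBB : 0 ≤ B + B := by positivity
  unfold modCont2
  refine le_trans ?_ (le_ciSup (f := fun h : ℝ × ℝ => ⨆ (_ : |h.1| ≤ δ ∧ |h.2| ≤ δ)
    (ts : ℝ × ℝ), |R (ts.1 + h.1) (ts.2 + h.2) - R ts.1 ts.2|) ⟨B + B, ?_⟩ (h₁, h₂))
  · refine le_trans ?_ (le_ciSup (f := fun _ : |h₁| ≤ δ ∧ |h₂| ≤ δ => ⨆ ts : ℝ × ℝ,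
      |R (ts.1 + h₁) (ts.2 + h₂) - R ts.1 ts.2|) ⟨B + B, ?_⟩ ⟨hh₁, hh₂⟩)
    · exact le_ciSup (f := fun ts : ℝ × ℝ => |R (ts.1 + h₁) (ts.2 + h₂) - R ts.1 ts.2|)
        ⟨B + B, by rintro _ ⟨q, rfl⟩; exact key _ _ _ _⟩ (t, s)
    · rintro _ ⟨_, rfl⟩
      exact Real.iSup_le (fun _ => key _ _ _ _) hBB
  · rintro _ ⟨p, rfl⟩
    exact Real.iSup_le (fun _ => Real.iSup_le (fun _ => key _ _ _ _) hBB) hBB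

lemma modCont2_mono (hB : ∀ t s, |R t s| ≤ B) : Monotone (modCont2 R) := fun _ _ h =>
  modCont2_le (modCont2_nonneg _ _) fun _ _ t s h₁ h₂ =>
    abs_sub_le_modCont2 hB (h₁.trans h) (h₂.trans h) t s

lemma exists_bound_of_periodic (hR : Continuous fun q : ℝ × ℝ => R q.1 q.2) {T : ℝ} (hT : 0 < T)
    (h₁ : ∀ t s, R (t + T) s = R t s) (h₂ : ∀ t s, R t (s + T) = R t s) :
    ∃ B, ∀ t s, |R t s| ≤ B := by
  obtain ⟨B, hB⟩ := (isCompact_Icc.prod isCompact_Icc :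
    IsCompact (Icc (0 : ℝ) T ×ˢ Icc (0 : ℝ) T)).exists_bound_of_continuousOn hR.continuousOn
  refine ⟨B, fun t s => ?_⟩
  obtain ⟨t', ht', ht⟩ := Function.Periodic.exists_mem_Ico₀ (f := fun t => R t s)
    (fun t => h₁ t s) hT t
  obtain ⟨s', hs', hs⟩ := Function.Periodic.exists_mem_Ico₀ (f := fun s => R t' s)
    (fun s => h₂ t' s) hT s
  rw [show R t s = R t' s from ht, show R t' s = R t' s' from hs]
  exact hB (t', s') ⟨Ico_subset_Icc_self ht', Ico_subset_Icc_self hs'⟩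

end ModulusOfContinuity

lemma AntitoneOn.summable_two_pow_mul {g : ℝ → ℝ} (hg : AntitoneOn g (Ioi 0))
    (hnn : ∀ x, 0 ≤ g x) (hint : IntegrableOn g (Ioi 0)) :
    Summable fun n : ℕ => 2 ^ n * g (2 ^ n) := by
  have hmono : Monotone fun n : ℕ => (2 : ℝ) ^ n := pow_right_mono₀ one_le_two
  have hsub : (⋃ n : ℕ, Ioc ((2 : ℝ) ^ n) (2 ^ (n + 1))) ⊆ Ioi 0 :=
    iUnion_subset fun n x hx => (by positivity : (0 : ℝ) < 2 ^ n).trans hx.1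
  have hs := (hasSum_integral_iUnion (f := g) (μ := volume)
    (s := fun n : ℕ => Ioc ((2 : ℝ) ^ n) (2 ^ (n + 1))) (fun _ => measurableSet_Ioc)
    (by simpa using hmono.pairwise_disjoint_on_Ioc_succ) (hint.mono_set hsub)).summable
  refine (summable_nat_add_iff 1).1 ((hs.mul_left 2).of_nonneg_of_le
    (fun n => mul_nonneg (by positivity) (hnn _)) fun n => ?_)
  have h := setIntegral_mono_on (μ := volume) (s := Ioc ((2 : ℝ) ^ n) (2 ^ (n + 1)))
    (f := fun _ => g (2 ^ (n + 1))) (g := g) (by simp)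
    (hint.mono_set (subset_iUnion_of_subset n subset_rfl |>.trans hsub)) measurableSet_Ioc
    fun x hx => hg ((by positivity : (0 : ℝ) < 2 ^ n).trans hx.1)
      (by simp : (0 : ℝ) < 2 ^ (n + 1)) hx.2
  simp only [integral_const, smul_eq_mul, MeasurableSet.univ, measureReal_restrict_apply,
    univ_inter, Real.volume_real_Ioc] at h
  rw [max_eq_left (by have := hmono (Nat.le_succ n); simpa using this)] at h
  calc (2 : ℝ) ^ (n + 1) * g (2 ^ (n + 1)) = 2 * ((2 ^ (n + 1) - 2 ^ n) * g (2 ^ (n + 1))) := by ring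
    _ ≤ _ := by gcongr

section Grid

/-- Number of points per unit length at level `n`. -/
def gridSize (n : ℕ) : ℕ := 4 ^ 4 ^ n

/-- The largest point of the level `n` grid not exceeding `t`. -/
def gridApprox (n : ℕ) (t : ℝ) : ℝ := ⌊t * gridSize n⌋ / gridSize n

/-- The level `n + 1` grid in the window `[-(n + 1), n + 1]`. -/
def windowGrid (n : ℕ) : Finset ℝ :=
  (Finset.Icc (-((n + 1) * gridSize (n + 1) : ℤ)) ((n + 1) * gridSize (n + 1))).image
    fun j : ℤ => (j : ℝ) / gridSize (n + 1)

lemma gridSize_pos (n : ℕ) : (0 : ℝ) < gridSize n := by simp [gridSize]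

lemma gridSize_succ (n : ℕ) : gridSize (n + 1) = gridSize n ^ 4 := by
  simp [gridSize, pow_succ, pow_mul]

lemma gridSize_le_succ (n : ℕ) : (gridSize n : ℝ) ≤ gridSize (n + 1) := by
  rw [gridSize_succ]
  exact_mod_cast Nat.le_self_pow (by norm_num) _

lemma three_mul_le_gridSize (n : ℕ) : 3 * (n + 1) ≤ gridSize n := by
  have h1 : n < 4 ^ n := Nat.lt_pow_self (by norm_num)
  obtain ⟨m, hm⟩ : ∃ m, 4 ^ n = m + 1 := ⟨4 ^ n - 1, by omega⟩
  have h2 : m < 4 ^ m := Nat.lt_pow_self (by norm_num)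
  rw [gridSize, hm, pow_succ]
  omega

lemma gridApprox_le (n : ℕ) (t : ℝ) : gridApprox n t ≤ t := by
  rw [gridApprox, div_le_iff₀ (gridSize_pos n)]
  exact Int.floor_le _

lemma sub_le_gridApprox (n : ℕ) (t : ℝ) : t - 1 / gridSize n ≤ gridApprox n t := by
  have h := gridSize_pos n
  rw [gridApprox, le_div_iff₀ h, sub_mul, one_div_mul_cancel h.ne']
  exact (Int.sub_one_lt_floor _).le

lemma abs_gridApprox_sub_le (n : ℕ) (t : ℝ) : |gridApprox n t - t| ≤ 1 / gridSize n := by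
  rw [abs_le]
  have := gridApprox_le n t
  have := sub_le_gridApprox n t
  have := one_div_pos.2 (gridSize_pos n)
  constructor <;> linarith

lemma abs_gridApprox_succ_sub_le (n : ℕ) (t : ℝ) :
    |gridApprox n t - gridApprox (n + 1) t| ≤ 1 / gridSize n := by
  have := gridApprox_le n t
  have := sub_le_gridApprox n t
  have := gridApprox_le (n + 1) t
  have := sub_le_gridApprox (n + 1) t
  have := one_div_pos.2 (gridSize_pos n)
  have := one_div_le_one_div_of_le (gridSize_pos n) (gridSize_le_succ n)
  rw [abs_le]
  constructor <;> linarith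

lemma abs_gridApprox_sub_gridApprox_le {n : ℕ} {t s : ℝ} (h : |t - s| ≤ 1 / gridSize n) :
    |gridApprox n t - gridApprox n s| ≤ 1 / gridSize n := by
  have hD := gridSize_pos n
  have key : ∀ {t s : ℝ}, |t - s| ≤ 1 / gridSize n →
      ⌊t * gridSize n⌋ ≤ ⌊s * gridSize n⌋ + 1 := by
    intro t s h
    rw [← Int.floor_add_one]
    apply Int.floor_le_floor
    have := (le_abs_self _).trans h
    rw [le_div_iff₀ hD] at this
    linarith
  have h1 : |((⌊t * gridSize n⌋ - ⌊s * gridSize n⌋ : ℤ) : ℝ)| ≤ 1 := by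
    have h1 := key h
    have h2 := key (abs_sub_comm t s ▸ h)
    exact_mod_cast (abs_le.2 ⟨by linarith, by linarith⟩ : |⌊t * gridSize n⌋ - ⌊s * gridSize n⌋| ≤ 1)
  rw [gridApprox, gridApprox, ← sub_div, abs_div, abs_of_pos hD]
  push_cast at h1
  gcongr

lemma abs_gridApprox_le {m n : ℕ} {t : ℝ} (h : |t| ≤ n) : |gridApprox m t| ≤ n + 1 := by
  have h1 : 1 / (gridSize m : ℝ) ≤ 1 := by
    rw [div_le_one (gridSize_pos m)]
    exact_mod_cast Nat.one_le_iff_ne_zero.2 (by simp [gridSize])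
  have h2 := abs_sub_abs_le_abs_sub (gridApprox m t) t
  linarith [abs_gridApprox_sub_le m t]

lemma mem_windowGrid {n : ℕ} {j : ℤ} (h : |(j / gridSize (n + 1) : ℝ)| ≤ n + 1) :
    (j / gridSize (n + 1) : ℝ) ∈ windowGrid n := by
  refine Finset.mem_image.2 ⟨j, ?_, rfl⟩
  rw [abs_div, abs_of_pos (gridSize_pos _), div_le_iff₀ (gridSize_pos _)] at h
  rw [Finset.mem_Icc, ← abs_le]
  exact_mod_cast h

lemma gridApprox_succ_mem_windowGrid {n : ℕ} {t : ℝ} (h : |t| ≤ n) :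
    gridApprox (n + 1) t ∈ windowGrid n :=
  mem_windowGrid (abs_gridApprox_le h)

lemma gridApprox_mem_windowGrid {n : ℕ} {t : ℝ} (h : |t| ≤ n) :
    gridApprox n t ∈ windowGrid n := by
  have hD := gridSize_pos n
  have h1 : gridApprox n t =
      ((⌊t * gridSize n⌋ * (gridSize n : ℤ) ^ 3 : ℤ) : ℝ) / gridSize (n + 1) := by
    rw [gridApprox, gridSize_succ]
    push_cast
    field_simp
  have h2 := abs_gridApprox_le (m := n) h
  rw [h1] at h2 ⊢
  exact mem_windowGrid h2

lemma card_windowGrid_le (n : ℕ) : (windowGrid n).card ≤ gridSize n ^ 5 := by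
  have h := three_mul_le_gridSize n
  have hD : 1 ≤ gridSize (n + 1) := Nat.one_le_iff_ne_zero.2 (by simp [gridSize])
  calc (windowGrid n).card ≤ _ := Finset.card_image_le
    _ ≤ 3 * (n + 1) * gridSize (n + 1) := by
      rw [Int.card_Icc, Int.toNat_le]
      push_cast
      nlinarith
    _ ≤ gridSize n * gridSize n ^ 4 := by rw [gridSize_succ]; gcongr
    _ = gridSize n ^ 5 := by ring

lemma gridSize_le_exp (n : ℕ) : (gridSize n : ℝ) ≤ exp (2 * 4 ^ n) := by
  have h : (4 : ℝ) ≤ exp 2 := by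
    have := Real.add_one_le_exp (1 : ℝ)
    rw [show (2 : ℝ) = 1 + 1 by norm_num, Real.exp_add]
    nlinarith
  have := pow_le_pow_left₀ (by norm_num) h (4 ^ n)
  rw [← Real.exp_nat_mul] at this
  push_cast [gridSize] at this ⊢
  rwa [mul_comm 2]

lemma one_div_gridSize_le (n : ℕ) : 1 / (gridSize n : ℝ) ≤ exp (-4 ^ n) := by
  have h : exp 1 ≤ 4 := by linarith [Real.exp_one_lt_d9]
  have := pow_le_pow_left₀ (exp_pos 1).le h (4 ^ n)
  rw [← Real.exp_nat_mul, mul_one] at this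
  rw [Real.exp_neg, one_div]
  push_cast [gridSize] at this ⊢
  gcongr

end Grid

section Continuity

variable {f : ℝ → ℝ} {a : ℕ → ℝ}

lemma exists_tendsto_gridApprox (ha : Summable a)
    (h : ∀ᶠ n in atTop, ∀ p ∈ windowGrid n, ∀ q ∈ windowGrid n,
      |p - q| ≤ 1 / gridSize n → |f p - f q| ≤ a n) (M : ℕ) :
    ∃ N, ∀ t : ℝ, |t| ≤ M → ∃ y, Tendsto (fun n => f (gridApprox n t)) atTop (𝓝 y) ∧
      ∀ n, |f (gridApprox (n + N) t) - y| ≤ ∑' m, a (m + (n + N)) := by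
  obtain ⟨N, hN⟩ := eventually_atTop.1 (h.and (eventually_ge_atTop M))
  refine ⟨N, fun t ht => ?_⟩
  have hstep : ∀ n, dist (f (gridApprox (n + N) t)) (f (gridApprox (n.succ + N) t))
      ≤ a (n + N) := by
    intro n
    obtain ⟨h1, h2⟩ := hN (n + N) (Nat.le_add_left _ _)
    have ht' : |t| ≤ (n + N : ℕ) := ht.trans (by exact_mod_cast h2)
    rw [Nat.succ_add, Real.dist_eq]
    exact h1 _ (gridApprox_mem_windowGrid ht') _ (gridApprox_succ_mem_windowGrid ht')
      (abs_gridApprox_succ_sub_le _ _)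
  have hs : Summable fun n => a (n + N) := (summable_nat_add_iff N).2 ha
  obtain ⟨y, hy⟩ := cauchySeq_tendsto_of_complete (cauchySeq_of_dist_le_of_summable _ hstep hs)
  refine ⟨y, (tendsto_add_atTop_iff_nat N).1 hy, fun n => ?_⟩
  have := dist_le_tsum_of_dist_le_of_tendsto _ hstep hs hy n
  rw [Real.dist_eq] at this
  refine this.trans_eq (tsum_congr fun m => ?_)
  congr 1
  ring

lemma tendsto_limUnder_gridApprox (ha : Summable a)
    (h : ∀ᶠ n in atTop, ∀ p ∈ windowGrid n, ∀ q ∈ windowGrid n,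
      |p - q| ≤ 1 / gridSize n → |f p - f q| ≤ a n) (t : ℝ) :
    Tendsto (fun n => f (gridApprox n t)) atTop
      (𝓝 (limUnder atTop fun n => f (gridApprox n t))) := by
  obtain ⟨M, hM⟩ := exists_nat_ge |t|
  obtain ⟨N, hN⟩ := exists_tendsto_gridApprox ha h M
  obtain ⟨y, hy, -⟩ := hN t hM
  exact tendsto_nhds_limUnder ⟨y, hy⟩

lemma continuous_limUnder_gridApprox (ha : Summable a)
    (h : ∀ᶠ n in atTop, ∀ p ∈ windowGrid n, ∀ q ∈ windowGrid n,
      |p - q| ≤ 1 / gridSize n → |f p - f q| ≤ a n) :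
    Continuous fun t => limUnder atTop fun n => f (gridApprox n t) := by
  refine continuous_iff_continuousAt.2 fun t => Metric.continuousAt_iff.2 fun ε hε => ?_
  obtain ⟨M, hM⟩ := exists_nat_ge (|t| + 1)
  obtain ⟨N, hN⟩ := exists_tendsto_gridApprox ha h M
  have hlim : Tendsto (fun n => (∑' m, a (m + n)) + a n + ∑' m, a (m + n)) atTop (𝓝 0) := by
    simpa using ((tendsto_sum_nat_add a).add ha.tendsto_atTop_zero).add (tendsto_sum_nat_add a)
  obtain ⟨n, hsmall, hn, hNn, hMn⟩ := ((hlim.eventually_lt_const hε).and (h.and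
    ((eventually_ge_atTop N).and (eventually_ge_atTop M)))).exists
  obtain ⟨k, rfl⟩ := Nat.exists_eq_add_of_le' hNn
  refine ⟨min 1 (1 / gridSize (k + N)), lt_min one_pos (one_div_pos.2 (gridSize_pos _)),
    fun s hs => ?_⟩
  rw [Real.dist_eq, lt_min_iff] at hs
  have hsM : |s| ≤ M := by linarith [abs_sub_abs_le_abs_sub s t, hs.1]
  have htM : |t| ≤ M := by linarith
  have key : ∀ u : ℝ, |u| ≤ M → |f (gridApprox (k + N) u) -
      limUnder atTop (fun n => f (gridApprox n u))| ≤ ∑' m, a (m + (k + N)) := by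
    intro u hu
    obtain ⟨y, hy, hyk⟩ := hN u hu
    rw [hy.limUnder_eq]
    exact hyk k
  have hMn' : (M : ℝ) ≤ (k + N : ℕ) := by exact_mod_cast hMn
  have h1 := hn _ (gridApprox_mem_windowGrid (hsM.trans hMn')) _
    (gridApprox_mem_windowGrid (htM.trans hMn')) (abs_gridApprox_sub_gridApprox_le hs.2.le)
  have h2 := key s hsM
  have h3 := key t htM
  rw [Real.dist_eq]
  rw [abs_le] at h1 h2 h3
  rw [abs_lt]
  constructor <;> linarith

end Continuity

section GaussianTail

variable {Ω : Type*} [MeasurableSpace Ω] {P : Measure Ω}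

lemma hasSubgaussianMGF_of_map_eq_gaussianReal {X : Ω → ℝ} {v c : NNReal}
    (hX : AEMeasurable X P) (h : P.map X = gaussianReal 0 v) (hvc : v ≤ c) :
    HasSubgaussianMGF X c P where
  integrable_exp_mul t := by
    have := integrable_exp_mul_gaussianReal (μ := 0) (v := v) t
    rw [← h] at this
    exact this.comp_aemeasurable hX
  mgf_le t := by
    rw [mgf_gaussianReal h t]
    gcongr
    simp only [zero_mul, zero_add]
    gcongr

lemma ProbabilityTheory.HasSubgaussianMGF.measureReal_le_abs_le {X : Ω → ℝ} {c : NNReal}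
    (h : HasSubgaussianMGF X c P) {ε : ℝ} (hε : 0 ≤ ε) :
    P.real {ω | ε ≤ |X ω|} ≤ 2 * exp (-ε ^ 2 / (2 * c)) := by
  have h1 := h.measure_ge_le hε
  have h2 := h.neg.measure_ge_le hε
  have hset : {ω | ε ≤ |X ω|} = {ω | ε ≤ X ω} ∪ {ω | ε ≤ (-X) ω} := by
    ext ω
    simp [le_abs]
  rw [hset]
  linarith [measureReal_union_le (μ := P) {ω | ε ≤ X ω} {ω | ε ≤ (-X) ω}]

variable {ξ : ℝ → Ω → ℝ}

lemma IsCenteredGaussianProcess.exists_map_sub (hg : IsCenteredGaussianProcess P ξ) (t s : ℝ) :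
    ∃ v, P.map (fun ω => ξ t ω - ξ s ω) = gaussianReal 0 v := by
  obtain ⟨v, hv⟩ := hg 2 ![1, -1] ![t, s]
  refine ⟨v, ?_⟩
  simpa [Fin.sum_univ_two, ← sub_eq_add_neg] using hv

lemma IsCenteredGaussianProcess.memLp_two (hg : IsCenteredGaussianProcess P ξ)
    (hm : ∀ t, Measurable (ξ t)) (t : ℝ) : MemLp (ξ t) 2 P := by
  obtain ⟨v, hv⟩ := hg 1 ![1] ![t]
  simp only [Fin.sum_univ_one, one_mul, Matrix.cons_val_fin_one] at hv
  have h := memLp_id_gaussianReal (μ := 0) (v := v) 2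
  change MemLp id 2 _ at h
  rw [← hv] at h
  exact h.comp_of_map (hm t).aemeasurable

lemma IsCenteredGaussianProcess.measureReal_le_abs_sub_le (hg : IsCenteredGaussianProcess P ξ)
    (hm : ∀ t, Measurable (ξ t)) {t s : ℝ} {c : NNReal}
    (hc : ∫ ω, (ξ t ω - ξ s ω) ^ 2 ∂P ≤ c) {ε : ℝ} (hε : 0 ≤ ε) :
    P.real {ω | ε ≤ |ξ t ω - ξ s ω|} ≤ 2 * exp (-ε ^ 2 / (2 * c)) := by
  obtain ⟨v, hv⟩ := hg.exists_map_sub t s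
  have hX : Measurable fun ω => ξ t ω - ξ s ω := (hm t).sub (hm s)
  have hvar : ∫ ω, (ξ t ω - ξ s ω) ^ 2 ∂P = v := by
    have h1 := variance_id_gaussianReal (μ := 0) (v := v)
    rw [variance_eq_integral (by fun_prop)] at h1
    simp only [id, integral_id_gaussianReal, sub_zero] at h1
    rw [← h1, ← hv, integral_map hX.aemeasurable (by fun_prop)]
  refine (hasSubgaussianMGF_of_map_eq_gaussianReal hX.aemeasurable hv ?_).measureReal_le_abs_le hε
  exact_mod_cast hvar ▸ hc

lemma IsCenteredGaussianProcess.integral_sub_sq_le (hg : IsCenteredGaussianProcess P ξ)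
    (hm : ∀ t, Measurable (ξ t)) {R : ℝ → ℝ → ℝ} {B : ℝ}
    (hR : ∀ t s, R t s = ∫ ω, ξ t ω * ξ s ω ∂P) (hB : ∀ t s, |R t s| ≤ B) {t s δ : ℝ}
    (hts : |t - s| ≤ δ) : ∫ ω, (ξ t ω - ξ s ω) ^ 2 ∂P ≤ 2 * modCont2 R δ := by
  have hi : ∀ t s, Integrable (fun ω => ξ t ω * ξ s ω) P := fun t s =>
    (hg.memLp_two hm t).integrable_mul (hg.memLp_two hm s)
  have hexp : ∫ ω, (ξ t ω - ξ s ω) ^ 2 ∂P = (R t t - R t s) - (R s t - R s s) := by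
    have h := integral_sub ((hi t t).sub (hi t s)) ((hi s t).sub (hi s s))
    simp only [Pi.sub_apply] at h
    rw [hR, hR, hR, hR, ← integral_sub (hi t t) (hi t s), ← integral_sub (hi s t) (hi s s), ← h]
    congr 1 with ω
    ring
  have hδ : |(0 : ℝ)| ≤ δ := by simpa using (abs_nonneg _).trans hts
  have h1 := (abs_le.1 (abs_sub_le_modCont2 hB hδ hts t s)).2
  have h2 := (abs_le.1 (abs_sub_le_modCont2 hB hδ hts s s)).1
  simp only [add_zero, add_sub_cancel] at h1 h2
  linarith

end GaussianTail

section BorelCantelli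

variable {Ω : Type*} [MeasurableSpace Ω] {P : Measure Ω} [IsFiniteMeasure P]

lemma ae_eventually_notMem_of_summable {s : ℕ → Set Ω} {b : ℕ → ℝ} (hb : Summable b)
    (h : ∀ n, P.real (s n) ≤ b n) : ∀ᵐ ω ∂P, ∀ᶠ n in atTop, ω ∉ s n := by
  refine ae_eventually_notMem ?_
  have h1 : ∀ n, P (s n) = ENNReal.ofReal (P.real (s n)) := fun n => by simp
  simp_rw [h1]
  exact (hb.of_nonneg_of_le (fun _ => measureReal_nonneg) h).tsum_ofReal_ne_top

lemma summable_two_mul_exp_neg_four_pow : Summable fun n : ℕ => 2 * exp (-4 ^ n) := by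
  refine (Real.summable_exp_neg_nat.of_nonneg_of_le (fun _ => (exp_pos _).le)
    fun n => ?_).mul_left 2
  have : (n : ℝ) ≤ 4 ^ n := by exact_mod_cast (Nat.lt_pow_self (by norm_num : 1 < 4)).le
  gcongr

variable {ξ : ℝ → Ω → ℝ} {a : ℕ → ℝ}

lemma ae_eventually_abs_sub_le_of_windowGrid
    (h : ∀ (n : ℕ) (p q : ℝ), |p - q| ≤ 1 / gridSize n →
      P.real {ω | a n ≤ |ξ p ω - ξ q ω|} ≤ 2 * exp (-(49 / 2) * 4 ^ n)) :
    ∀ᵐ ω ∂P, ∀ᶠ n in atTop, ∀ p ∈ windowGrid n, ∀ q ∈ windowGrid n,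
      |p - q| ≤ 1 / gridSize n → |ξ p ω - ξ q ω| ≤ a n := by
  classical
  let T : ℕ → Finset (ℝ × ℝ) := fun n =>
    (windowGrid n ×ˢ windowGrid n).filter fun r => |r.1 - r.2| ≤ 1 / gridSize n
  have hT : ∀ n, ((T n).card : ℝ) ≤ exp (20 * 4 ^ n) := by
    intro n
    have h1 : (T n).card ≤ gridSize n ^ 10 := by
      refine (Finset.card_filter_le _ _).trans ?_
      rw [Finset.card_product]
      calc _ ≤ gridSize n ^ 5 * gridSize n ^ 5 :=
            Nat.mul_le_mul (card_windowGrid_le n) (card_windowGrid_le n)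
        _ = _ := by ring
    calc ((T n).card : ℝ) ≤ (gridSize n : ℝ) ^ 10 := by exact_mod_cast h1
      _ ≤ exp (2 * 4 ^ n) ^ 10 := by gcongr; exact gridSize_le_exp n
      _ = _ := by rw [← Real.exp_nat_mul]; push_cast; ring_nf
  have hae := ae_eventually_notMem_of_summable (P := P)
    (s := fun n => ⋃ r ∈ T n, {ω | a n ≤ |ξ r.1 ω - ξ r.2 ω|})
    summable_two_mul_exp_neg_four_pow fun n => by
      refine (measureReal_biUnion_finset_le _ _).trans ?_
      refine (Finset.sum_le_card_nsmul _ _ _ fun r hr =>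
        h n r.1 r.2 (Finset.mem_filter.1 hr).2).trans ?_
      rw [nsmul_eq_mul]
      calc _ ≤ exp (20 * 4 ^ n) * (2 * exp (-(49 / 2) * 4 ^ n)) := by gcongr; exact hT n
        _ = 2 * exp (20 * 4 ^ n + -(49 / 2) * 4 ^ n) := by rw [Real.exp_add]; ring
        _ ≤ _ := by
          gcongr
          have : (0 : ℝ) < 4 ^ n := by positivity
          linarith
  filter_upwards [hae] with ω hω
  filter_upwards [hω] with n hn p hp q hq hpq
  simp only [mem_iUnion, mem_ofPred_eq, not_exists, not_le] at hn
  exact (hn (p, q) (Finset.mem_filter.2 ⟨Finset.mk_mem_product hp hq, hpq⟩)).le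

lemma ae_tendsto_gridApprox (ha : Tendsto a atTop (𝓝 0))
    (h : ∀ (n : ℕ) (p q : ℝ), |p - q| ≤ 1 / gridSize n →
      P.real {ω | a n ≤ |ξ p ω - ξ q ω|} ≤ 2 * exp (-(49 / 2) * 4 ^ n)) (t : ℝ) :
    ∀ᵐ ω ∂P, Tendsto (fun n => ξ (gridApprox n t) ω) atTop (𝓝 (ξ t ω)) := by
  have hae := ae_eventually_notMem_of_summable (P := P)
    (s := fun n => {ω | a n ≤ |ξ (gridApprox n t) ω - ξ t ω|})
    summable_two_mul_exp_neg_four_pow fun n => by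
      refine (h n _ _ (abs_gridApprox_sub_le n t)).trans ?_
      gcongr
      have : (0 : ℝ) < 4 ^ n := by positivity
      linarith
  filter_upwards [hae] with ω hω
  rw [tendsto_iff_dist_tendsto_zero]
  refine squeeze_zero' (Eventually.of_forall fun _ => dist_nonneg) ?_ ha
  filter_upwards [hω] with n hn
  exact (not_le.1 hn).le

end BorelCantelli

lemma summable_two_pow_mul_sqrt_modCont2 {R : ℝ → ℝ → ℝ} {B : ℝ} (hB : ∀ t s, |R t s| ≤ B)
    (hR : IntegrableOn (fun x => √(modCont2 R (exp (-(x ^ 2))))) (Ioi 0)) :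
    Summable fun n : ℕ => 2 ^ n * √(modCont2 R (exp (-4 ^ n))) := by
  have hanti : AntitoneOn (fun x => √(modCont2 R (exp (-(x ^ 2))))) (Ioi 0) := by
    intro x hx y _ hxy
    have hx0 : 0 ≤ x := le_of_lt hx
    exact Real.sqrt_le_sqrt (modCont2_mono hB (by gcongr))
  refine (hanti.summable_two_pow_mul (fun _ => Real.sqrt_nonneg _) hR).congr fun n => ?_
  rw [← pow_mul, mul_comm n 2, pow_mul]
  norm_num

/-- Fernique's condition. If the centered 2π-periodic Gaussian process `ξ`
has continuous covariance `R` with `∫₀^∞ ω(R, e^{−x²})^{1/2} dx < ∞`, then `ξ` has a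
modification with almost surely continuous sample paths. -/
theorem gaussian_continuity_fernique
    {Ω : Type*} [MeasurableSpace Ω] (P : Measure Ω) [IsProbabilityMeasure P]
    (ξ : ℝ → Ω → ℝ)
    (hmeas : Measurable (fun q : ℝ × Ω => ξ q.1 q.2))
    (hper : ∀ t ω, ξ (t + 2 * π) ω = ξ t ω)
    (hgauss : IsCenteredGaussianProcess P ξ)
    (R : ℝ → ℝ → ℝ) (hRdef : ∀ t s, R t s = ∫ ω, ξ t ω * ξ s ω ∂P)
    (hRcont : Continuous fun q : ℝ × ℝ => R q.1 q.2)
    (hFernique :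
      IntegrableOn (fun x => Real.sqrt (modCont2 R (Real.exp (-(x ^ 2))))) (Ioi (0:ℝ))) :
    ∃ ξ' : ℝ → Ω → ℝ,
      (∀ t, ξ' t =ᵐ[P] ξ t) ∧
      (∀ᵐ ω ∂P, Continuous fun t => ξ' t ω) := by
  have hm : ∀ t, Measurable (ξ t) := fun t => hmeas.comp measurable_prodMk_left
  obtain ⟨B, hB⟩ := exists_bound_of_periodic hRcont two_pi_pos
    (fun t s => by simp only [hRdef, hper]) (fun t s => by simp only [hRdef, hper])
  let σ : ℕ → ℝ := fun n => √2 * √(modCont2 R (exp (-4 ^ n))) + (1 / 4) ^ n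
  let a : ℕ → ℝ := fun n => 7 * 2 ^ n * σ n
  have hσ : ∀ n, 0 < σ n := fun n => by positivity
  have ha : Summable a := by
    have h1 := (summable_two_pow_mul_sqrt_modCont2 hB hFernique).mul_left (7 * √2)
    have h2 := (summable_geometric_of_lt_one (r := (1 / 2 : ℝ)) (by norm_num)
      (by norm_num)).mul_left 7
    refine (h1.add h2).congr fun n => ?_
    have h3 : (1 / 2 : ℝ) ^ n = 2 ^ n * (1 / 4) ^ n := by rw [← mul_pow]; norm_num
    simp only [a, σ, h3]
    ring
  have htail : ∀ (n : ℕ) (p q : ℝ), |p - q| ≤ 1 / gridSize n →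
      P.real {ω | a n ≤ |ξ p ω - ξ q ω|} ≤ 2 * exp (-(49 / 2) * 4 ^ n) := by
    intro n p q hpq
    have hvar : ∫ ω, (ξ p ω - ξ q ω) ^ 2 ∂P ≤ (Real.toNNReal (σ n ^ 2) : ℝ) := by
      rw [Real.coe_toNNReal _ (sq_nonneg _)]
      refine (hgauss.integral_sub_sq_le hm hRdef hB (hpq.trans (one_div_gridSize_le n))).trans ?_
      calc 2 * modCont2 R (exp (-4 ^ n)) = (√2 * √(modCont2 R (exp (-4 ^ n)))) ^ 2 := by
            rw [mul_pow, Real.sq_sqrt zero_le_two, Real.sq_sqrt (modCont2_nonneg _ _)]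
        _ ≤ σ n ^ 2 := by
            gcongr
            exact le_add_of_nonneg_right (by positivity)
    refine (hgauss.measureReal_le_abs_sub_le hm hvar
      (mul_pos (by positivity) (hσ n)).le).trans_eq ?_
    rw [Real.coe_toNNReal _ (sq_nonneg _)]
    congr 2
    have h4 : (4 : ℝ) ^ n = (2 ^ n) ^ 2 := by rw [← pow_mul, mul_comm, pow_mul]; norm_num
    have := (hσ n).ne'
    rw [h4]
    field_simp
    ring
  have hgrid := ae_eventually_abs_sub_le_of_windowGrid htail
  refine ⟨fun t ω => limUnder atTop fun n => ξ (gridApprox n t) ω, fun t => ?_, ?_⟩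
  · filter_upwards [ae_tendsto_gridApprox ha.tendsto_atTop_zero htail t] with ω hω
    exact hω.limUnder_eq
  · filter_upwards [hgrid] with ω hω
    exact continuous_limUnder_gridApprox (f := fun t => ξ t ω) ha hω
end
end

section
/- Let n ≥ 1 and let B : ℝ → ℝ be a trigonometric polynomial of degree at most n, not identically zero. Then the Lebesgue measure of the set { t ∈ [0,2π] : |B(t)| ≥ (1/2) · sup_{s∈[0,2π]} |B(s)| } is at least 1/(2n). -/
open MeasureTheory Real Set

noncomputable section

/-- A real trigonometric polynomial of degree at most `n`. -/
def IsTrigPoly (n : ℕ) (g : ℝ → ℝ) : Prop :=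
  ∃ (a : ℕ → ℝ) (b : ℕ → ℝ), ∀ x : ℝ,
    g x = a 0 + ∑ k ∈ Finset.Icc 1 n, (a k * Real.cos (k * x) + b k * Real.sin (k * x))

/-- `n` times the Fejér kernel, as the squared modulus of a sum of exponentials. -/
def fejerSum (n : ℕ) (t : ℝ) : ℝ :=
  ∑ j ∈ Finset.range n, ∑ l ∈ Finset.range n, Real.cos (((j : ℝ) - l) * t)

lemma fejerSum_nonneg (n : ℕ) (t : ℝ) : 0 ≤ fejerSum n t := by
  have h : fejerSum n t = (∑ j ∈ Finset.range n, Real.cos (j * t)) ^ 2 +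
      (∑ j ∈ Finset.range n, Real.sin (j * t)) ^ 2 := by
    simp only [fejerSum, sq, Finset.sum_mul_sum, ← Finset.sum_add_distrib, sub_mul, Real.cos_sub]
  rw [h]
  positivity

lemma continuous_fejerSum (n : ℕ) : Continuous (fejerSum n) := by
  unfold fejerSum
  fun_prop

lemma integral_cos_int_mul (m : ℤ) :
    ∫ t in (0 : ℝ)..(2 * π), Real.cos (m * t) = if m = 0 then 2 * π else 0 := by
  split_ifs with h
  · simp [h]
  · have hm : (m : ℝ) ≠ 0 := by exact_mod_cast h
    rw [intervalIntegral.integral_comp_mul_left _ hm, integral_cos, mul_zero, Real.sin_zero,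
      ← zero_add ((m : ℝ) * (2 * π)), Real.sin_add_int_mul_two_pi]
    simp

lemma integral_sin_int_mul (m : ℤ) : ∫ t in (0 : ℝ)..(2 * π), Real.sin (m * t) = 0 := by
  by_cases h : m = 0
  · simp [h]
  · have hm : (m : ℝ) ≠ 0 := by exact_mod_cast h
    rw [intervalIntegral.integral_comp_mul_left _ hm, integral_sin, mul_zero, Real.cos_zero,
      ← zero_add ((m : ℝ) * (2 * π)), Real.cos_add_int_mul_two_pi]
    simp

lemma integral_mul_fejerSum (n : ℕ) {g : ℝ → ℝ} (hg : Continuous g) :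
    ∫ t in (0 : ℝ)..(2 * π), g t * fejerSum n t = ∑ j ∈ Finset.range n, ∑ l ∈ Finset.range n,
      ∫ t in (0 : ℝ)..(2 * π), g t * Real.cos (((j : ℝ) - l) * t) := by
  simp only [fejerSum, Finset.mul_sum]
  rw [intervalIntegral.integral_finsetSum
    fun j _ => Continuous.intervalIntegrable (by fun_prop) _ _]
  refine Finset.sum_congr rfl fun j _ => ?_
  rw [intervalIntegral.integral_finsetSum
    fun l _ => Continuous.intervalIntegrable (by fun_prop) _ _]

lemma integral_fejerSum (n : ℕ) : ∫ t in (0 : ℝ)..(2 * π), fejerSum n t = 2 * π * n := by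
  have h := integral_mul_fejerSum n (g := fun _ => 1) continuous_const
  simp only [one_mul] at h
  rw [h]
  have (j l : ℕ) : ∫ t in (0 : ℝ)..(2 * π), Real.cos (((j : ℝ) - l) * t) =
      if j = l then 2 * π else 0 := by
    have h := integral_cos_int_mul ((j : ℤ) - l)
    push_cast at h
    rw [h]
    simp only [sub_eq_zero, Nat.cast_inj]
  simp only [this, Finset.sum_ite_eq, Finset.mem_range]
  rw [Finset.sum_congr rfl fun j hj => if_pos (Finset.mem_range.1 hj)]
  simp [mul_comm]

lemma integral_cos_mul_cos (m d : ℤ) :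
    ∫ t in (0 : ℝ)..(2 * π), Real.cos (m * t) * Real.cos (d * t) =
      π * ((if m + d = 0 then 1 else 0) + if m - d = 0 then 1 else 0) := by
  have h (t : ℝ) : Real.cos (m * t) * Real.cos (d * t) =
      1 / 2 * (Real.cos ((m + d : ℤ) * t) + Real.cos ((m - d : ℤ) * t)) := by
    push_cast
    rw [add_mul, sub_mul, Real.cos_add, Real.cos_sub]
    ring
  simp only [h]
  rw [intervalIntegral.integral_const_mul, intervalIntegral.integral_add
    (Continuous.intervalIntegrable (by fun_prop) _ _)
    (Continuous.intervalIntegrable (by fun_prop) _ _), integral_cos_int_mul, integral_cos_int_mul]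
  split_ifs <;> ring

lemma integral_sin_mul_cos (m d : ℤ) :
    ∫ t in (0 : ℝ)..(2 * π), Real.sin (m * t) * Real.cos (d * t) = 0 := by
  have h (t : ℝ) : Real.sin (m * t) * Real.cos (d * t) =
      1 / 2 * (Real.sin ((m + d : ℤ) * t) + Real.sin ((m - d : ℤ) * t)) := by
    push_cast
    rw [add_mul, sub_mul, Real.sin_add, Real.sin_sub]
    ring
  simp only [h]
  rw [intervalIntegral.integral_const_mul, intervalIntegral.integral_add
    (Continuous.intervalIntegrable (by fun_prop) _ _)
    (Continuous.intervalIntegrable (by fun_prop) _ _), integral_sin_int_mul, integral_sin_int_mul]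
  simp

lemma integral_sin_mul_fejerSum (n : ℕ) (m : ℤ) :
    ∫ t in (0 : ℝ)..(2 * π), Real.sin (m * t) * fejerSum n t = 0 := by
  rw [integral_mul_fejerSum n (by fun_prop)]
  refine Finset.sum_eq_zero fun j _ => Finset.sum_eq_zero fun l _ => ?_
  exact_mod_cast integral_sin_mul_cos m (j - l)

lemma sum_indicator_sub_eq {n k : ℕ} (hk : k ≤ n) :
    ∑ j ∈ Finset.range n, ∑ l ∈ Finset.range n,
      (if (n : ℤ) - k + (j - l) = 0 then 1 else 0 : ℝ) = k := by
  have h : ∀ j ∈ Finset.range n, ∑ l ∈ Finset.range n,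
      (if (n : ℤ) - k + (j - l) = 0 then 1 else 0 : ℝ) = if j ∈ Finset.range k then 1 else 0 := by
    intro j _
    have h' (l : ℕ) : (n : ℤ) - k + (j - l) = 0 ↔ n - k + j = l := by omega
    simp only [h', Finset.sum_ite_eq, Finset.mem_range]
    congr 1
    exact propext (by omega)
  rw [Finset.sum_congr rfl h, Finset.sum_ite_mem,
    Finset.inter_eq_right.2 (Finset.range_mono hk)]
  simp

lemma integral_cos_sub_mul_fejerSum {n k : ℕ} (hk : k ≤ n) :
    ∫ t in (0 : ℝ)..(2 * π), Real.cos (((n : ℤ) - k : ℤ) * t) * fejerSum n t = 2 * π * k := by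
  rw [integral_mul_fejerSum n (by fun_prop)]
  have h (j l : ℕ) : ∫ t in (0 : ℝ)..(2 * π),
      Real.cos (((n : ℤ) - k : ℤ) * t) * Real.cos (((j : ℝ) - l) * t) =
      π * ((if (n : ℤ) - k + (j - l) = 0 then 1 else 0) +
        if (n : ℤ) - k + (l - j) = 0 then 1 else 0) := by
    have := integral_cos_mul_cos ((n : ℤ) - k) (j - l)
    rw [sub_sub_eq_add_sub, add_sub_assoc] at this
    exact_mod_cast this
  simp only [h, ← Finset.mul_sum, Finset.sum_add_distrib]
  rw [sum_indicator_sub_eq hk, Finset.sum_comm, sum_indicator_sub_eq hk]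
  ring

lemma integral_cos_add_mul_fejerSum (n k : ℕ) :
    ∫ t in (0 : ℝ)..(2 * π), Real.cos (((n : ℤ) + k : ℤ) * t) * fejerSum n t = 0 := by
  rw [integral_mul_fejerSum n (by fun_prop)]
  refine Finset.sum_eq_zero fun j hj => Finset.sum_eq_zero fun l hl => ?_
  rw [Finset.mem_range] at hj hl
  have := integral_cos_mul_cos ((n : ℤ) + k) (j - l)
  rw [if_neg (by omega), if_neg (by omega)] at this
  simpa using this

lemma integral_sin_mul_kernel {n k : ℕ} (hk : k ≤ n) :
    ∫ t in (0 : ℝ)..(2 * π), Real.sin (k * t) * (2 * Real.sin (n * t) * fejerSum n t) =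
      2 * π * k := by
  have h (t : ℝ) : Real.sin (k * t) * (2 * Real.sin (n * t) * fejerSum n t) =
      Real.cos (((n : ℤ) - k : ℤ) * t) * fejerSum n t -
        Real.cos (((n : ℤ) + k : ℤ) * t) * fejerSum n t := by
    push_cast
    rw [add_mul, sub_mul, Real.cos_add, Real.cos_sub]
    ring
  have hF := continuous_fejerSum n
  simp only [h]
  rw [intervalIntegral.integral_sub
    (Continuous.intervalIntegrable (by fun_prop) _ _)
    (Continuous.intervalIntegrable (by fun_prop) _ _), integral_cos_sub_mul_fejerSum hk,
    integral_cos_add_mul_fejerSum, sub_zero]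

lemma integral_cos_mul_kernel (n k : ℕ) :
    ∫ t in (0 : ℝ)..(2 * π), Real.cos (k * t) * (2 * Real.sin (n * t) * fejerSum n t) = 0 := by
  have h (t : ℝ) : Real.cos (k * t) * (2 * Real.sin (n * t) * fejerSum n t) =
      Real.sin (((n : ℤ) + k : ℤ) * t) * fejerSum n t +
        Real.sin (((n : ℤ) - k : ℤ) * t) * fejerSum n t := by
    push_cast
    rw [add_mul, sub_mul, Real.sin_add, Real.sin_sub]
    ring
  have hF := continuous_fejerSum n
  simp only [h]
  rw [intervalIntegral.integral_add
    (Continuous.intervalIntegrable (by fun_prop) _ _)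
    (Continuous.intervalIntegrable (by fun_prop) _ _), integral_sin_mul_fejerSum,
    integral_sin_mul_fejerSum, add_zero]

lemma integral_harmonic_mul_kernel {n k : ℕ} (hk : k ≤ n) (a b x : ℝ) :
    ∫ t in (0 : ℝ)..(2 * π), (a * Real.cos (k * (x + t)) + b * Real.sin (k * (x + t))) *
        (2 * Real.sin (n * t) * fejerSum n t) =
      2 * π * (a * (-Real.sin (k * x) * k) + b * (Real.cos (k * x) * k)) := by
  have h (t : ℝ) : (a * Real.cos (k * (x + t)) + b * Real.sin (k * (x + t))) *
        (2 * Real.sin (n * t) * fejerSum n t) =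
      (a * Real.cos (k * x) + b * Real.sin (k * x)) *
          (Real.cos (k * t) * (2 * Real.sin (n * t) * fejerSum n t)) +
        (b * Real.cos (k * x) - a * Real.sin (k * x)) *
          (Real.sin (k * t) * (2 * Real.sin (n * t) * fejerSum n t)) := by
    rw [mul_add, Real.cos_add, Real.sin_add]
    ring
  have hF := continuous_fejerSum n
  simp only [h]
  rw [intervalIntegral.integral_add
    (Continuous.intervalIntegrable (by fun_prop) _ _)
    (Continuous.intervalIntegrable (by fun_prop) _ _), intervalIntegral.integral_const_mul,
    intervalIntegral.integral_const_mul, integral_cos_mul_kernel, integral_sin_mul_kernel hk]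
  ring

lemma IsTrigPoly.continuous {n : ℕ} {B : ℝ → ℝ} (hB : IsTrigPoly n B) : Continuous B := by
  obtain ⟨a, b, h⟩ := hB
  rw [funext h]
  fun_prop

lemma IsTrigPoly.periodic {n : ℕ} {B : ℝ → ℝ} (hB : IsTrigPoly n B) :
    Function.Periodic B (2 * π) := by
  obtain ⟨a, b, h⟩ := hB
  intro x
  simp only [h, mul_add, Real.cos_add_nat_mul_two_pi, Real.sin_add_nat_mul_two_pi]

lemma IsTrigPoly.hasDerivAt {n : ℕ} {B : ℝ → ℝ} (hB : IsTrigPoly n B) (x : ℝ) :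
    HasDerivAt B ((2 * π)⁻¹ *
      ∫ t in (0 : ℝ)..(2 * π), B (x + t) * (2 * Real.sin (n * t) * fejerSum n t)) x := by
  obtain ⟨a, b, h⟩ := hB
  have hF := continuous_fejerSum n
  have hint : ∫ t in (0 : ℝ)..(2 * π), B (x + t) * (2 * Real.sin (n * t) * fejerSum n t) =
      2 * π * ∑ k ∈ Finset.Icc 1 n,
        (a k * (-Real.sin (k * x) * k) + b k * (Real.cos (k * x) * k)) := by
    have h0 := integral_harmonic_mul_kernel (Nat.zero_le n) (a 0) 0 x
    simp only [Nat.cast_zero, zero_mul, Real.cos_zero, mul_one, add_zero, mul_zero] at h0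
    simp only [h, add_mul, Finset.sum_mul _ _ (2 * Real.sin _ * _)]
    simp only [← add_mul]
    rw [intervalIntegral.integral_add
      (Continuous.intervalIntegrable (by fun_prop) _ _)
      (Continuous.intervalIntegrable (by fun_prop) _ _), h0, zero_add,
      intervalIntegral.integral_finsetSum
        fun k _ => Continuous.intervalIntegrable (by fun_prop) _ _, Finset.mul_sum]
    exact Finset.sum_congr rfl fun k hk =>
      integral_harmonic_mul_kernel (Finset.mem_Icc.1 hk).2 _ _ _
  rw [hint, inv_mul_cancel_left₀ (by positivity), funext h]
  refine HasDerivAt.const_add _ (HasDerivAt.fun_sum fun k _ => ?_)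
  have hk : HasDerivAt (fun y : ℝ => (k : ℝ) * y) k x := by
    simpa using (hasDerivAt_id x).const_mul (k : ℝ)
  exact (hk.cos.const_mul _).add (hk.sin.const_mul _)

/-- Bernstein's inequality with the non-sharp constant `2`. -/
lemma IsTrigPoly.abs_deriv_le {n : ℕ} {B : ℝ → ℝ} (hB : IsTrigPoly n B) {M : ℝ}
    (hM : ∀ x, |B x| ≤ M) (x : ℝ) : |deriv B x| ≤ 2 * n * M := by
  have hF := continuous_fejerSum n
  have hc := hB.continuous
  have hint : |∫ t in (0 : ℝ)..(2 * π), B (x + t) * (2 * Real.sin (n * t) * fejerSum n t)| ≤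
      ∫ t in (0 : ℝ)..(2 * π), 2 * M * fejerSum n t := by
    rw [← Real.norm_eq_abs]
    refine intervalIntegral.norm_integral_le_of_norm_le Real.two_pi_pos.le
      (Filter.Eventually.of_forall fun t _ => ?_)
      ((hF.const_mul (2 * M)).intervalIntegrable _ _)
    rw [Real.norm_eq_abs, abs_mul, abs_mul, abs_mul, abs_two, abs_of_nonneg (fejerSum_nonneg n t)]
    have h1 : |B (x + t)| * |Real.sin (n * t)| ≤ M * 1 :=
      mul_le_mul (hM _) (Real.abs_sin_le_one _) (abs_nonneg _) ((abs_nonneg _).trans (hM 0))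
    nlinarith [mul_le_mul_of_nonneg_right h1 (fejerSum_nonneg n t)]
  rw [intervalIntegral.integral_const_mul, integral_fejerSum] at hint
  rw [(hB.hasDerivAt x).deriv, abs_mul, abs_of_pos (by positivity : (0 : ℝ) < (2 * π)⁻¹),
    inv_mul_le_iff₀ (by positivity)]
  linarith

lemma volume_inter_Icc_two_pi_ge {S : Set ℝ} (hS : MeasurableSet S)
    (hper : ∀ x, x + 2 * π ∈ S ↔ x ∈ S) {c δ : ℝ} (hδ : δ < π) (hc : Icc (c - δ) (c + δ) ⊆ S) :
    ENNReal.ofReal (2 * δ) ≤ volume (S ∩ Icc 0 (2 * π)) := by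
  have hinv (g : AddSubgroup.zmultiples (2 * π)) :
      (fun x => g +ᵥ x) ⁻¹' S = S := by
    have hp : Function.Periodic (· ∈ S) (2 * π) := fun x => propext (hper x)
    obtain ⟨_, m, rfl⟩ := g
    ext x
    have := hp.zsmul m x
    simp only [AddSubgroup.vadd_def, mem_preimage, vadd_eq_add]
    rw [add_comm]
    exact iff_of_eq this
  have key := (isAddFundamentalDomain_Ioc Real.two_pi_pos (c - π)).measure_set_eq
    (isAddFundamentalDomain_Ioc Real.two_pi_pos 0) (μ := volume) hS hinv
  rw [zero_add] at key
  calc ENNReal.ofReal (2 * δ) = volume (Icc (c - δ) (c + δ)) := by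
        rw [Real.volume_Icc]; ring_nf
    _ ≤ volume (S ∩ Ioc (c - π) (c - π + 2 * π)) :=
        measure_mono fun x hx => ⟨hc hx, by linarith [hx.1], by linarith [hx.2]⟩
    _ = volume (S ∩ Ioc 0 (2 * π)) := key
    _ ≤ _ := measure_mono (inter_subset_inter_right _ Ioc_subset_Icc_self)

/-- for a trigonometric polynomial `B ≠ 0` of degree at most `n ≥ 1`,
the set where `|B| ≥ ½ sup_{[0,2π]} |B|` has Lebesgue measure at least `1/(2n)`
within `[0,2π]`. -/
theorem trig_poly_level_set_measure
    (n : ℕ) (hn : 1 ≤ n) (B : ℝ → ℝ) (hB : IsTrigPoly n B)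
    (hB0 : ∃ x : ℝ, B x ≠ 0) :
    ENNReal.ofReal (1 / (2 * (n : ℝ))) ≤
      volume {t ∈ Icc (0:ℝ) (2 * π) |
        (1 / 2) * (⨆ s ∈ Icc (0:ℝ) (2 * π), |B s|) ≤ |B t|} := by
  obtain ⟨c, hc, hmax⟩ := isCompact_Icc.exists_isMaxOn
    (nonempty_Icc.2 Real.two_pi_pos.le) hB.continuous.abs.continuousOn
  have hM (x : ℝ) : |B x| ≤ |B c| := by
    obtain ⟨y, hy, hxy⟩ := hB.periodic.exists_mem_Ico₀ Real.two_pi_pos x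
    rw [hxy]
    exact hmax (Ico_subset_Icc_self hy)
  have hsup : (⨆ s ∈ Icc (0 : ℝ) (2 * π), |B s|) ≤ |B c| :=
    Real.iSup_le (fun s => Real.iSup_le (fun _ => hM s) (abs_nonneg _)) (abs_nonneg _)
  have hn' : (1 : ℝ) ≤ n := by exact_mod_cast hn
  have hsub : Icc (c - 1 / (4 * n)) (c + 1 / (4 * n)) ⊆ {t | 1 / 2 * |B c| ≤ |B t|} := by
    intro t ht
    have hlip : |B c - B t| ≤ 2 * n * |B c| * |c - t| :=
      convex_univ.norm_image_sub_le_of_norm_deriv_le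
        (fun x _ => (hB.hasDerivAt x).differentiableAt)
        (fun x _ => hB.abs_deriv_le hM x) (mem_univ t) (mem_univ c)
    have hdist : |c - t| ≤ 1 / (4 * n) := abs_le.2 ⟨by linarith [ht.2], by linarith [ht.1]⟩
    have h1 : 2 * n * |B c| * |c - t| ≤ 1 / 2 * |B c| := by
      calc 2 * n * |B c| * |c - t| ≤ 2 * n * |B c| * (1 / (4 * n)) := by gcongr
        _ = 1 / 2 * |B c| := by field_simp; ring
    change 1 / 2 * |B c| ≤ |B t|
    linarith [abs_sub_abs_le_abs_sub (B c) (B t)]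
  have hδ : 1 / (4 * (n : ℝ)) < π := by
    rw [div_lt_iff₀ (by positivity)]
    nlinarith [Real.pi_gt_three]
  calc ENNReal.ofReal (1 / (2 * (n : ℝ))) = ENNReal.ofReal (2 * (1 / (4 * n))) := by
        congr 1; field_simp; norm_num
    _ ≤ volume ({t | 1 / 2 * |B c| ≤ |B t|} ∩ Icc 0 (2 * π)) :=
        volume_inter_Icc_two_pi_ge
          (isClosed_le continuous_const hB.continuous.abs).measurableSet
          (fun x => by simp only [mem_ofPred_eq, hB.periodic x]) hδ hsub
    _ ≤ _ := by
        refine measure_mono fun t ht => ⟨ht.2, ?_⟩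
        exact (mul_le_mul_of_nonneg_left hsup (by norm_num)).trans ht.1
end
end

section
/- Let n ≥ 1, let λ > 0, and let Z be a random trigonometric polynomial of degree at most n, i.e., Z(ω, t) = a₀(ω) + ∑_{k=1}^n (a_k(ω) cos(kt) + b_k(ω) sin(kt)) with measurable real coefficients. Assume the quantity J := (2π)^{−1} E ∫₀^{2π} ( e^{λ Z(t)} + e^{−λ Z(t)} ) dt is finite. Then E[ ‖Z‖_∞ ] ≤ (2/λ) · [ log(4πn) + log J ], where ‖Z‖_∞ = sup_{t∈[0,2π]} |Z(t)|. -/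
open MeasureTheory Real Set

noncomputable section

/-- The Dirichlet kernel `∑_{|k| ≤ p} cos (k s)`. -/
def dirichletKernel (p : ℕ) (s : ℝ) : ℝ := ∑ k ∈ Finset.Icc (-(p : ℤ)) p, Real.cos (k * s)

lemma continuous_dirichletKernel (p : ℕ) : Continuous (dirichletKernel p) := by
  unfold dirichletKernel
  fun_prop

lemma abs_dirichletKernel_le (p : ℕ) (s : ℝ) : |dirichletKernel p s| ≤ 2 * p + 1 := by
  refine (Finset.abs_sum_le_sum_abs _ _).trans ?_
  refine (Finset.sum_le_card_nsmul _ _ 1 fun k _ => Real.abs_cos_le_one _).trans (le_of_eq ?_)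
  have h : ((p : ℤ) + 1 - -(p : ℤ)).toNat = 2 * p + 1 := by omega
  rw [Int.card_Icc, h]
  simp

lemma dirichletKernel_eq_sum_exp (p : ℕ) (s : ℝ) :
    (dirichletKernel p s : ℂ) =
      ∑ k ∈ Finset.Icc (-(p : ℤ)) p, Complex.exp (k * s * Complex.I) := by
  have hneg : ∑ k ∈ Finset.Icc (-(p : ℤ)) p, Complex.exp (-(k * s * Complex.I)) =
      ∑ k ∈ Finset.Icc (-(p : ℤ)) p, Complex.exp (k * s * Complex.I) := by
    refine Finset.sum_nbij' (fun k => -k) (fun k => -k) ?_ ?_ ?_ ?_ ?_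
    · intro k hk
      simp only [Finset.mem_Icc] at hk ⊢
      omega
    · intro k hk
      simp only [Finset.mem_Icc] at hk ⊢
      omega
    · simp
    · simp
    · intro k _
      congr 1
      push_cast
      ring
  unfold dirichletKernel
  push_cast
  simp only [Complex.cos, ← Finset.sum_div, Finset.sum_add_distrib, neg_mul]
  rw [hneg]
  ring

lemma integral_exp_int_mul_I (m : ℤ) :
    ∫ t in (0 : ℝ)..2 * π, Complex.exp (m * t * Complex.I) = if m = 0 then 2 * (π : ℂ) else 0 := by
  split_ifs with h
  · simp [h]
  · have hc : (m : ℂ) * Complex.I ≠ 0 := by simp [h]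
    have h1 : ∀ t : ℝ, (m : ℂ) * t * Complex.I = m * Complex.I * t := fun t => by ring
    simp only [h1]
    rw [integral_exp_mul_complex hc]
    have h2 : (m : ℂ) * Complex.I * ((2 * π : ℝ) : ℂ) = m * (2 * π * Complex.I) := by
      push_cast
      ring
    rw [h2, Complex.exp_int_mul_two_pi_mul_I]
    simp

/-- A product of two Dirichlet kernels reproduces the characters of low frequency. -/
lemma integral_exp_mul_dirichletKernel_mul (p q : ℕ) (k : ℤ) (hk : |k| + q ≤ p) (x : ℝ) :
    ∫ t in (0 : ℝ)..2 * π, Complex.exp (k * t * Complex.I) *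
        ((dirichletKernel q (x - t) * dirichletKernel p (x - t) : ℝ) : ℂ) =
      (2 * π * (2 * q + 1) : ℝ) * Complex.exp (k * x * Complex.I) := by
  have hexp : ∀ t : ℝ, Complex.exp (k * t * Complex.I) *
        ((dirichletKernel q (x - t) * dirichletKernel p (x - t) : ℝ) : ℂ) =
      ∑ j ∈ Finset.Icc (-(q : ℤ)) q, ∑ l ∈ Finset.Icc (-(p : ℤ)) p,
        Complex.exp ((j + l : ℤ) * x * Complex.I) *
          Complex.exp ((k - j - l : ℤ) * t * Complex.I) := by
    intro t
    rw [Complex.ofReal_mul, dirichletKernel_eq_sum_exp, dirichletKernel_eq_sum_exp,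
      Finset.sum_mul_sum, Finset.mul_sum]
    refine Finset.sum_congr rfl fun j _ => ?_
    rw [Finset.mul_sum]
    refine Finset.sum_congr rfl fun l _ => ?_
    rw [← Complex.exp_add, ← Complex.exp_add, ← Complex.exp_add]
    congr 1
    push_cast
    ring
  simp only [hexp]
  rw [intervalIntegral.integral_finsetSum
    fun j _ => Continuous.intervalIntegrable (by fun_prop) _ _]
  have hj : ∀ j ∈ Finset.Icc (-(q : ℤ)) q,
      ∫ t in (0 : ℝ)..2 * π, ∑ l ∈ Finset.Icc (-(p : ℤ)) p,
        Complex.exp ((j + l : ℤ) * x * Complex.I) *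
          Complex.exp ((k - j - l : ℤ) * t * Complex.I) =
      2 * π * Complex.exp (k * x * Complex.I) := by
    intro j hj
    rw [intervalIntegral.integral_finsetSum
      fun l _ => Continuous.intervalIntegrable (by fun_prop) _ _]
    simp only [intervalIntegral.integral_const_mul, integral_exp_int_mul_I]
    rw [Finset.sum_eq_single (k - j)]
    · rw [if_pos (by ring), show j + (k - j) = k by ring]
      ring
    · intro l _ hl
      rw [if_neg (by omega), mul_zero]
    · intro hmem
      refine absurd ?_ hmem
      simp only [Finset.mem_Icc] at hj ⊢
      have := abs_le.mp (show |k| ≤ (p : ℤ) - q by omega)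
      omega
  have h : ((q : ℤ) + 1 - -(q : ℤ)).toNat = 2 * q + 1 := by omega
  rw [Finset.sum_congr rfl hj, Finset.sum_const, Int.card_Icc, h, nsmul_eq_mul]
  push_cast
  ring

lemma integral_cos_mul_dirichletKernel_mul (p q : ℕ) (k : ℕ) (hk : k + q ≤ p) (x : ℝ) :
    ∫ t in (0 : ℝ)..2 * π, Real.cos (k * t) *
        (dirichletKernel q (x - t) * dirichletKernel p (x - t)) =
      2 * π * (2 * q + 1) * Real.cos (k * x) := by
  have hD := continuous_dirichletKernel
  have h := congrArg Complex.re (integral_exp_mul_dirichletKernel_mul p q k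
    (by rw [Nat.abs_cast]; exact_mod_cast hk) x)
  have hc : IntervalIntegrable (fun t : ℝ => Complex.exp ((k : ℤ) * t * Complex.I) *
      ((dirichletKernel q (x - t) * dirichletKernel p (x - t) : ℝ) : ℂ)) volume 0 (2 * π) :=
    Continuous.intervalIntegrable (by fun_prop) _ _
  have e := Complex.reCLM.intervalIntegral_comp_comm hc
  simp only [Complex.reCLM_apply] at e
  rw [← e, Complex.re_ofReal_mul] at h
  have hcos : ∀ t : ℝ, (Complex.exp ((k : ℤ) * t * Complex.I)).re = Real.cos (k * t) := by
    intro t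
    rw [← Complex.exp_ofReal_mul_I_re]
    push_cast
    rfl
  simpa only [Complex.re_mul_ofReal, hcos] using h

lemma integral_sin_mul_dirichletKernel_mul (p q : ℕ) (k : ℕ) (hk : k + q ≤ p) (x : ℝ) :
    ∫ t in (0 : ℝ)..2 * π, Real.sin (k * t) *
        (dirichletKernel q (x - t) * dirichletKernel p (x - t)) =
      2 * π * (2 * q + 1) * Real.sin (k * x) := by
  have hD := continuous_dirichletKernel
  have h := congrArg Complex.im (integral_exp_mul_dirichletKernel_mul p q k
    (by rw [Nat.abs_cast]; exact_mod_cast hk) x)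
  have hc : IntervalIntegrable (fun t : ℝ => Complex.exp ((k : ℤ) * t * Complex.I) *
      ((dirichletKernel q (x - t) * dirichletKernel p (x - t) : ℝ) : ℂ)) volume 0 (2 * π) :=
    Continuous.intervalIntegrable (by fun_prop) _ _
  have e := Complex.imCLM.intervalIntegral_comp_comm hc
  simp only [Complex.imCLM_apply] at e
  rw [← e, Complex.im_ofReal_mul] at h
  have hsin : ∀ t : ℝ, (Complex.exp ((k : ℤ) * t * Complex.I)).im = Real.sin (k * t) := by
    intro t
    rw [← Complex.exp_ofReal_mul_I_im]
    push_cast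
    rfl
  simpa only [Complex.im_mul_ofReal, hsin] using h

lemma integral_dirichletKernel_sq (q : ℕ) (x : ℝ) :
    ∫ t in (0 : ℝ)..2 * π, dirichletKernel q (x - t) ^ 2 = 2 * π * (2 * q + 1) := by
  simpa [sq] using integral_cos_mul_dirichletKernel_mul q q 0 (by simp) x

/-- The real trigonometric polynomial of degree at most `n` with coefficients `a` and `b`. -/
def trigPoly (n : ℕ) (a b : ℕ → ℝ) (t : ℝ) : ℝ :=
  a 0 + ∑ k ∈ Finset.Icc 1 n, (a k * Real.cos (k * t) + b k * Real.sin (k * t))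

lemma continuous_trigPoly (n : ℕ) (a b : ℕ → ℝ) : Continuous (trigPoly n a b) := by
  unfold trigPoly
  fun_prop

lemma integral_trigPoly_mul_dirichletKernel_mul (n p q : ℕ) (hp : n + q ≤ p) (a b : ℕ → ℝ)
    (x : ℝ) :
    ∫ t in (0 : ℝ)..2 * π, trigPoly n a b t *
        (dirichletKernel q (x - t) * dirichletKernel p (x - t)) =
      2 * π * (2 * q + 1) * trigPoly n a b x := by
  have hD := continuous_dirichletKernel
  have h0 := integral_cos_mul_dirichletKernel_mul p q 0 (by omega) x
  simp only [Nat.cast_zero, zero_mul, Real.cos_zero, one_mul, mul_one] at h0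
  simp only [trigPoly, add_mul, Finset.sum_mul, mul_assoc (a _), mul_assoc (b _)]
  rw [intervalIntegral.integral_add (Continuous.intervalIntegrable (by fun_prop) _ _)
      (Continuous.intervalIntegrable (by fun_prop) _ _),
    intervalIntegral.integral_const_mul, h0, intervalIntegral.integral_finsetSum
      fun j _ => Continuous.intervalIntegrable (by fun_prop) _ _,
    mul_add _ (a 0), Finset.mul_sum]
  congr 1
  · ring
  · refine Finset.sum_congr rfl fun k hk => ?_
    have hkn := (Finset.mem_Icc.mp hk).2
    rw [intervalIntegral.integral_add (Continuous.intervalIntegrable (by fun_prop) _ _)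
        (Continuous.intervalIntegrable (by fun_prop) _ _),
      intervalIntegral.integral_const_mul, intervalIntegral.integral_const_mul,
      integral_cos_mul_dirichletKernel_mul p q k (by omega),
      integral_sin_mul_dirichletKernel_mul p q k (by omega)]
    ring

/-- A pointwise bound for a trigonometric polynomial through its exponential integral. -/
lemma exp_half_abs_trigPoly_le (n : ℕ) (hn : 1 ≤ n) (lam : ℝ) (hlam : 0 < lam) (a b : ℕ → ℝ)
    (x : ℝ) :
    Real.exp (lam * |trigPoly n a b x| / 2) ≤
      2 * n * ∫ t in (0 : ℝ)..2 * π,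
        (Real.exp (lam * trigPoly n a b t) + Real.exp (-(lam * trigPoly n a b t))) := by
  have hD := continuous_dirichletKernel
  have hT := continuous_trigPoly n a b
  have hn' : (1 : ℝ) ≤ n := by exact_mod_cast hn
  have h2π : (0 : ℝ) ≤ 2 * π := by positivity
  set f := trigPoly n a b
  set c := lam * |f x| / 2 with hc
  set w : ℝ → ℝ := fun t =>
    (dirichletKernel n (x - t) ^ 2 + dirichletKernel (2 * n) (x - t) ^ 2) / 2 with hw
  have hwc : Continuous w := by fun_prop
  have hw0 : ∀ t, 0 ≤ w t := fun t => by positivity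
  have hwint : ∫ t in (0 : ℝ)..2 * π, w t = π * (6 * n + 2) := by
    simp only [hw, intervalIntegral.integral_div]
    rw [intervalIntegral.integral_add (Continuous.intervalIntegrable (by fun_prop) _ _)
      (Continuous.intervalIntegrable (by fun_prop) _ _), integral_dirichletKernel_sq,
      integral_dirichletKernel_sq]
    push_cast
    ring
  have hwle : ∀ t, w t ≤ 10 * n ^ 2 + 6 * n + 1 := by
    intro t
    have h1 := sq_le_sq' (abs_le.mp (abs_dirichletKernel_le n (x - t))).1
      (abs_le.mp (abs_dirichletKernel_le n (x - t))).2
    have h2 := sq_le_sq' (abs_le.mp (abs_dirichletKernel_le (2 * n) (x - t))).1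
      (abs_le.mp (abs_dirichletKernel_le (2 * n) (x - t))).2
    push_cast at h2
    simp only [hw]
    linarith
  have hrep : 2 * π * (2 * n + 1) * |f x| ≤ ∫ t in (0 : ℝ)..2 * π, |f t| * w t := by
    have h := integral_trigPoly_mul_dirichletKernel_mul n (2 * n) n (by omega) a b x
    change ∫ t in (0 : ℝ)..2 * π, f t * _ = _ * f x at h
    have habs := congrArg abs h
    rw [abs_mul, abs_of_nonneg (show (0 : ℝ) ≤ 2 * π * (2 * n + 1) by positivity)] at habs
    rw [← habs]
    refine (intervalIntegral.abs_integral_le_integral_abs h2π).trans ?_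
    refine intervalIntegral.integral_mono_on h2π
      (Continuous.intervalIntegrable (by fun_prop) _ _)
      (Continuous.intervalIntegrable (by fun_prop) _ _) fun t _ => ?_
    rw [abs_mul]
    refine mul_le_mul_of_nonneg_left ?_ (abs_nonneg _)
    refine abs_le.mpr ⟨?_, ?_⟩
    · simp only [hw]
      nlinarith [sq_nonneg (dirichletKernel n (x - t) + dirichletKernel (2 * n) (x - t))]
    · simp only [hw]
      nlinarith [sq_nonneg (dirichletKernel n (x - t) - dirichletKernel (2 * n) (x - t))]
  set g : ℝ → ℝ := fun t => Real.exp (lam * f t) + Real.exp (-(lam * f t)) with hg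
  have hgc : Continuous g := by fun_prop
  have hg0 : ∀ t, 0 ≤ g t := fun t => by positivity
  have htangent : ∀ t, Real.exp c * ((1 - c) * w t + lam * (|f t| * w t)) ≤ g t * w t := by
    intro t
    have h1 : Real.exp (lam * |f t|) ≤ g t := by
      rcases abs_cases (f t) with ⟨h, _⟩ | ⟨h, _⟩
      · rw [h]
        exact le_add_of_nonneg_right (Real.exp_pos _).le
      · rw [h, mul_neg]
        exact le_add_of_nonneg_left (Real.exp_pos _).le
    have h2 : Real.exp c * (1 - c + lam * |f t|) ≤ Real.exp (lam * |f t|) := by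
      have h3 := mul_le_mul_of_nonneg_left (Real.add_one_le_exp (lam * |f t| - c))
        (Real.exp_pos c).le
      rw [← Real.exp_add, add_sub_cancel] at h3
      linarith
    calc _ = Real.exp c * (1 - c + lam * |f t|) * w t := by ring
      _ ≤ g t * w t := mul_le_mul_of_nonneg_right (h2.trans h1) (hw0 t)
  have hlow : Real.exp c * (π * (6 * n + 2)) ≤ ∫ t in (0 : ℝ)..2 * π, g t * w t := by
    refine le_trans ?_ (intervalIntegral.integral_mono_on h2π
      (Continuous.intervalIntegrable (by fun_prop) _ _)
      (Continuous.intervalIntegrable (by fun_prop) _ _) fun t _ => htangent t)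
    rw [intervalIntegral.integral_const_mul,
      intervalIntegral.integral_add (Continuous.intervalIntegrable (by fun_prop) _ _)
      (Continuous.intervalIntegrable (by fun_prop) _ _), intervalIntegral.integral_const_mul,
      intervalIntegral.integral_const_mul, hwint]
    refine mul_le_mul_of_nonneg_left ?_ (Real.exp_pos c).le
    have h1 := mul_le_mul_of_nonneg_left hrep hlam.le
    have h2 : 0 ≤ π * (n + 1) * (lam * |f x|) := by positivity
    rw [hc]
    nlinarith
  have hup : ∫ t in (0 : ℝ)..2 * π, g t * w t ≤
      (10 * n ^ 2 + 6 * n + 1) * ∫ t in (0 : ℝ)..2 * π, g t := by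
    rw [← intervalIntegral.integral_const_mul]
    refine intervalIntegral.integral_mono_on h2π
      (Continuous.intervalIntegrable (by fun_prop) _ _)
      (Continuous.intervalIntegrable (by fun_prop) _ _) fun t _ => ?_
    rw [mul_comm]
    exact mul_le_mul_of_nonneg_right (hwle t) (hg0 t)
  have hI : 0 ≤ ∫ t in (0 : ℝ)..2 * π, g t :=
    intervalIntegral.integral_nonneg h2π fun t _ => hg0 t
  have hconst : (10 * n ^ 2 + 6 * n + 1 : ℝ) ≤ 2 * n * (π * (6 * n + 2)) := by
    have h1 : (3 : ℝ) * (2 * n * (6 * n + 2)) ≤ π * (2 * n * (6 * n + 2)) :=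
      mul_le_mul_of_nonneg_right Real.pi_gt_three.le (by positivity)
    nlinarith
  have hpos : 0 < π * (6 * n + 2) := by positivity
  refine le_of_mul_le_mul_right ?_ hpos
  calc Real.exp c * (π * (6 * n + 2)) ≤ _ := hlow.trans hup
    _ ≤ 2 * n * (π * (6 * n + 2)) * ∫ t in (0 : ℝ)..2 * π, g t :=
      mul_le_mul_of_nonneg_right hconst hI
    _ = _ := by ring

lemma four_pi_le_integral_exp_add_exp_neg (f : ℝ → ℝ) (hf : Continuous f) :
    4 * π ≤ ∫ t in (0 : ℝ)..2 * π, (Real.exp (f t) + Real.exp (-f t)) := by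
  have h : ∫ _ in (0 : ℝ)..2 * π, (2 : ℝ) = 4 * π := by
    rw [intervalIntegral.integral_const, smul_eq_mul]
    ring
  rw [← h]
  refine intervalIntegral.integral_mono_on (by positivity)
    (Continuous.intervalIntegrable (by fun_prop) _ _)
    (Continuous.intervalIntegrable (by fun_prop) _ _) fun t _ => ?_
  linarith [Real.add_one_le_exp (f t), Real.add_one_le_exp (-f t)]

/-- for a random trigonometric polynomial `Z` of degree at most `n ≥ 1` with
measurable coefficients and `J := (2π)⁻¹ E ∫₀^{2π} (e^{λZ(t)} + e^{−λZ(t)}) dt < ∞`,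
one has `E‖Z‖_∞ ≤ (2/λ)(log(4πn) + log J)`. -/
theorem random_trig_poly_exp_moment_bound
    {Ω : Type*} [MeasurableSpace Ω] (P : Measure Ω) [IsProbabilityMeasure P]
    (n : ℕ) (hn : 1 ≤ n) (lam : ℝ) (hlam : 0 < lam)
    (a : ℕ → Ω → ℝ) (b : ℕ → Ω → ℝ)
    (ha : ∀ k, Measurable (a k)) (hb : ∀ k, Measurable (b k))
    (Z : Ω → ℝ → ℝ)
    (hZ : ∀ ω t, Z ω t =
      a 0 ω + ∑ k ∈ Finset.Icc 1 n, (a k ω * Real.cos (k * t) + b k ω * Real.sin (k * t)))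
    (hint : Integrable
      (fun ω => ∫ t in Icc (0:ℝ) (2 * π),
        (Real.exp (lam * Z ω t) + Real.exp (-(lam * Z ω t)))) P)
    (J : ℝ)
    (hJ : J = (2 * π)⁻¹ *
      ∫ ω, (∫ t in Icc (0:ℝ) (2 * π),
        (Real.exp (lam * Z ω t) + Real.exp (-(lam * Z ω t)))) ∂P) :
    (∫ ω, (⨆ t ∈ Icc (0:ℝ) (2 * π), |Z ω t|) ∂P) ≤
      (2 / lam) * (Real.log (4 * π * n) + Real.log J) := by
  have hZ' : ∀ ω t, Z ω t = trigPoly n (fun k => a k ω) (fun k => b k ω) t := hZ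
  have hIcc : ∀ ω, (∫ t in Icc (0:ℝ) (2 * π),
      (Real.exp (lam * Z ω t) + Real.exp (-(lam * Z ω t)))) =
      ∫ t in (0 : ℝ)..2 * π, (Real.exp (lam * Z ω t) + Real.exp (-(lam * Z ω t))) := fun ω => by
    rw [integral_Icc_eq_integral_Ioc, intervalIntegral.integral_of_le (by positivity)]
  simp only [hIcc] at hint hJ
  set I : Ω → ℝ := fun ω =>
    ∫ t in (0 : ℝ)..2 * π, (Real.exp (lam * Z ω t) + Real.exp (-(lam * Z ω t))) with hI
  have hI4 : ∀ ω, 4 * π ≤ I ω := by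
    intro ω
    refine four_pi_le_integral_exp_add_exp_neg (fun t => lam * Z ω t) ?_
    simp only [hZ']
    exact (continuous_trigPoly _ _ _).const_mul _
  have hIpos : ∀ ω, 0 < I ω := fun ω => lt_of_lt_of_le (by positivity) (hI4 ω)
  have hJ' : ∫ ω, I ω ∂P = 2 * π * J := by
    rw [hJ]
    field_simp
  have hJpos : 0 < J := by
    have h := integral_mono (integrable_const (4 * π)) hint hI4
    rw [integral_const, probReal_univ, one_smul, hJ'] at h
    nlinarith [Real.pi_pos]
  have hpt : ∀ ω t, |Z ω t| ≤
      (2 / lam) * (Real.log (4 * π * n) + Real.log J + (I ω / (2 * π * J) - 1)) := by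
    intro ω t
    have h := exp_half_abs_trigPoly_le n hn lam hlam (fun k => a k ω) (fun k => b k ω) t
    simp only [← hZ'] at h
    have hprod : 2 * n * I ω = 4 * π * n * J * (I ω / (2 * π * J)) := by
      field_simp
      ring
    have hq : 0 < I ω / (2 * π * J) := div_pos (hIpos ω) (by positivity)
    have h1 := (Real.le_log_iff_exp_le (mul_pos (by positivity) (hIpos ω))).mpr h
    change _ ≤ Real.log (2 * n * I ω) at h1
    rw [hprod, Real.log_mul (by positivity) hq.ne', Real.log_mul (by positivity) hJpos.ne'] at h1
    have h2 := Real.log_le_sub_one_of_pos hq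
    rw [div_mul_eq_mul_div, le_div_iff₀ hlam]
    linarith
  have hdev : Integrable (fun ω => I ω / (2 * π * J) - 1) P :=
    (hint.div_const _).sub (integrable_const _)
  have hint' : Integrable (fun ω =>
      (2 / lam) * (Real.log (4 * π * n) + Real.log J + (I ω / (2 * π * J) - 1))) P :=
    ((integrable_const _).add hdev).const_mul _
  calc (∫ ω, (⨆ t ∈ Icc (0:ℝ) (2 * π), |Z ω t|) ∂P)
      ≤ ∫ ω, (2 / lam) *
          (Real.log (4 * π * n) + Real.log J + (I ω / (2 * π * J) - 1)) ∂P := by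
        refine integral_mono_of_nonneg (ae_of_all _ fun ω => ?_) hint' (ae_of_all _ fun ω => ?_)
        · exact Real.iSup_nonneg fun t => Real.iSup_nonneg fun _ => abs_nonneg _
        · have h0 := (abs_nonneg _).trans (hpt ω 0)
          exact Real.iSup_le (fun t => Real.iSup_le (fun _ => hpt ω t) h0) h0
    _ = (2 / lam) * (Real.log (4 * π * n) + Real.log J) := by
        rw [integral_const_mul, integral_add (integrable_const _) hdev,
          integral_sub (hint.div_const _) (integrable_const _), integral_div, hJ']
        simp only [integral_const, probReal_univ, one_smul]
        rw [div_self (by positivity)]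
        ring
end
end

section
/- Let η₁,…,η_N be real random variables that are linearly independent in the sense that no nontrivial real linear combination ∑_{k=1}^N c_k η_k vanishes almost surely, and let h₁,…,h_N : ℕ → ℝ be deterministic sequences. Define the random degenerate sequence ξ(n) = ∑_{k=1}^N η_k h_k(n). Then P( lim_{n→∞} ξ(n) = 0 ) = 1 if and only if lim_{n→∞} E[ arctan|ξ(n)| ] = 0. -/
open MeasureTheory Real Set Filter

noncomputable section

theorem integrable_arctan_abs {Ω : Type*} [MeasurableSpace Ω] (P : Measure Ω)
    [IsFiniteMeasure P] {X : Ω → ℝ} (hX : Measurable X) :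
    Integrable (fun ω => Real.arctan |X ω|) P := by
  refine Integrable.of_bound (C := π / 2) (by fun_prop) (ae_of_all _ fun ω => ?_)
  rw [Real.norm_eq_abs]
  exact (abs_lt.2 ⟨Real.neg_pi_div_two_lt_arctan _, Real.arctan_lt_pi_div_two _⟩).le

theorem tendsto_integral_arctan_abs {Ω ι : Type*} [MeasurableSpace Ω] (P : Measure Ω)
    [IsFiniteMeasure P] {l : Filter ι} [l.IsCountablyGenerated] {X : ι → Ω → ℝ} {Y : Ω → ℝ}
    (hX : ∀ i, Measurable (X i)) (hlim : ∀ᵐ ω ∂P, Tendsto (fun i => X i ω) l (nhds (Y ω))) :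
    Tendsto (fun i => ∫ ω, Real.arctan |X i ω| ∂P) l (nhds (∫ ω, Real.arctan |Y ω| ∂P)) := by
  refine tendsto_integral_filter_of_dominated_convergence (fun _ => π / 2)
    (Eventually.of_forall fun i => (integrable_arctan_abs P (hX i)).aestronglyMeasurable)
    (Eventually.of_forall fun i => ae_of_all _ fun ω => ?_) (integrable_const _) ?_
  · rw [Real.norm_eq_abs]
    exact (abs_lt.2 ⟨Real.neg_pi_div_two_lt_arctan _, Real.arctan_lt_pi_div_two _⟩).le
  · filter_upwards [hlim] with ω hω
    exact (Real.continuous_arctan.tendsto _).comp hω.abs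

/-- If no nontrivial linear combination of the `η k` vanishes almost surely, then
`E[arctan|∑ c_k η_k|]` is bounded away from zero for coefficient vectors `c` bounded away from
zero. -/
theorem exists_pos_le_integral_arctan_abs_linear_combination
    {Ω ι : Type*} [Fintype ι] [MeasurableSpace Ω] (P : Measure Ω) [IsFiniteMeasure P]
    (η : ι → Ω → ℝ) (hmeas : ∀ k, Measurable (η k))
    (hindep : ∀ c : ι → ℝ, (∀ᵐ ω ∂P, ∑ k, c k * η k ω = 0) → c = 0) {ε : ℝ} (hε : 0 < ε) :
    ∃ δ > 0, ∀ c : ι → ℝ, ε ≤ ‖c‖ → δ ≤ ∫ ω, Real.arctan |∑ k, c k * η k ω| ∂P := by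
  have hm (c : ι → ℝ) : Measurable (fun ω => ∑ k, c k * η k ω) := by fun_prop
  have hcont : Continuous (fun c : ι → ℝ => ∫ ω, Real.arctan |∑ k, c k * η k ω| ∂P) := by
    refine continuous_iff_continuousAt.2 fun c => tendsto_integral_arctan_abs P hm
      (ae_of_all _ fun ω => ?_)
    exact Continuous.tendsto (by fun_prop) c
  have hnonneg (c : ι → ℝ) : 0 ≤ fun ω => Real.arctan |∑ k, c k * η k ω| := fun ω =>
    Real.arctan_nonneg.2 (abs_nonneg _)
  have hpos : ∀ c ∈ Metric.sphere (0 : ι → ℝ) ε,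
      0 < ∫ ω, Real.arctan |∑ k, c k * η k ω| ∂P := by
    intro c hc
    refine (integral_nonneg (hnonneg c)).lt_of_ne fun h0 => ?_
    have hae := (integral_eq_zero_iff_of_nonneg (hnonneg c)
      (integrable_arctan_abs P (hm c))).1 h0.symm
    have hc0 : c = 0 := hindep c <| by
      filter_upwards [hae] with ω hω
      simpa using hω
    simp [hc0, hε.ne] at hc
  obtain ⟨δ, hδ, hle⟩ := (isCompact_sphere (0 : ι → ℝ) ε).exists_forall_le'
    hcont.continuousOn hpos
  refine ⟨δ, hδ, fun c hc => ?_⟩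
  have hc0 : 0 < ‖c‖ := hε.trans_le hc
  refine (hle ((ε / ‖c‖) • c) ?_).trans ?_
  · rw [mem_sphere_zero_iff_norm, norm_smul, Real.norm_of_nonneg (by positivity)]
    field_simp
  · refine integral_mono (integrable_arctan_abs P (hm _)) (integrable_arctan_abs P (hm _))
      fun ω => Real.arctan_mono ?_
    simp only [Pi.smul_apply, smul_eq_mul, mul_assoc, ← Finset.mul_sum]
    rw [abs_mul, abs_of_nonneg (by positivity)]
    exact mul_le_of_le_one_left (abs_nonneg _) ((div_le_one hc0).2 hc)

/-- for a random degenerate sequence `ξ(n) = ∑_{k=1}^N η_k h_k(n)` with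
linearly independent random variables `η_k` (no nontrivial linear combination vanishes
a.s.), `ξ(n) → 0` almost surely iff `E[arctan|ξ(n)|] → 0`. -/
theorem degenerate_sequence_as_convergence
    {Ω : Type*} [MeasurableSpace Ω] (P : Measure Ω) [IsProbabilityMeasure P]
    (N : ℕ) (η : Fin N → Ω → ℝ) (hmeas : ∀ k, Measurable (η k))
    (hindep : ∀ c : Fin N → ℝ, (∀ᵐ ω ∂P, ∑ k, c k * η k ω = 0) → c = 0)
    (h : Fin N → ℕ → ℝ)
    (ξ : ℕ → Ω → ℝ) (hξ : ∀ n ω, ξ n ω = ∑ k, η k ω * h k n) :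
    P {ω | Tendsto (fun n => ξ n ω) atTop (nhds 0)} = 1 ↔
      Tendsto (fun n => ∫ ω, Real.arctan |ξ n ω| ∂P) atTop (nhds 0) := by
  have hξm : ∀ n, Measurable (ξ n) := fun n => by
    rw [funext (hξ n)]
    fun_prop
  constructor
  · intro hP
    have hae : ∀ᵐ ω ∂P, Tendsto (fun n => ξ n ω) atTop (nhds 0) :=
      (mem_ae_iff_prob_eq_one (measurableSet_tendsto (nhds 0) hξm)).2 hP
    simpa using tendsto_integral_arctan_abs P hξm hae
  · intro hE
    have hH : Tendsto (fun n k => h k n) atTop (nhds 0) := by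
      refine Metric.tendsto_nhds.2 fun ε hε => ?_
      obtain ⟨δ, hδ, hle⟩ :=
        exists_pos_le_integral_arctan_abs_linear_combination P η hmeas hindep hε
      filter_upwards [hE.eventually_lt_const hδ] with n hn
      rw [dist_zero_right]
      by_contra! hge
      refine hn.not_ge ((hle _ hge).trans_eq ?_)
      simp only [hξ, mul_comm]
    have hall : ∀ ω, Tendsto (fun n => ξ n ω) atTop (nhds 0) := fun ω => by
      simp only [hξ]
      simpa using tendsto_finsetSum Finset.univ fun k _ =>
        (tendsto_pi_nhds.1 hH k).const_mul (η k ω)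
    simp [hall]
end
end
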